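/- For every admissible right-infinite word w = (w₀,w₁,w₂,…) ∈ W₊, the series ζ_w(x) := −Σ_{k=1}^∞ φ'_{w_{0,k}}(x) · τ'(φ_{w_{0,k}}(x)) converges uniformly on I_{w_0} and defines a smooth function ζ_w : I_{w_0} → ℝ satisfying |ζ_w(x)| ≤ (θ/(1−θ)) · max_{y∈I}|τ'(y)|; moreover, for every α ∈ ℕ there exists a constant C_α > 0, independent of w, such that |ζ_w^{(α)}(x)| ≤ C_α for all x ∈ I_{w_0}. -/

import Mathlib

/-- Composition `φ_{w_{0,k}} := φ_{w_{k−1},w_k} ∘ ⋯ ∘ φ_{w_0,w_1}` along a right-infinite word. -/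
def rightComp {N : ℕ} (φ : Fin N → Fin N → ℝ → ℝ) (w : ℕ → Fin N) : ℕ → ℝ → ℝ
  | 0 => id
  | k + 1 => φ (w k) (w (k + 1)) ∘ rightComp φ w k

/-- `ζ_w(x) := −Σ_{k≥1} φ'_{w_{0,k}}(x) · τ'(φ_{w_{0,k}}(x))`. -/
noncomputable def zetaFn {N : ℕ} (φ : Fin N → Fin N → ℝ → ℝ) (τ : ℝ → ℝ)
    (w : ℕ → Fin N) (x : ℝ) : ℝ :=
  -∑' k : ℕ, deriv (rightComp φ w (k + 1)) x * deriv τ (rightComp φ w (k + 1) x)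

open Set Filter

/-- Term-by-term differentiation of a series of functions on a compact interval. -/
theorem hasDerivWithinAt_tsum_Icc {f f' : ℕ → ℝ → ℝ} {u : ℕ → ℝ} {a b x : ℝ}
    (hu : Summable u) (hf : ∀ n y, HasDerivAt (f n) (f' n y) y) (hc : ∀ n, Continuous (f' n))
    (hb : ∀ n, ∀ y ∈ Icc a b, |f' n y| ≤ u n) (hs : Summable fun n => f n a)
    (hx : x ∈ Icc a b) :
    HasDerivWithinAt (fun y => ∑' n, f n y) (∑' n, f' n x) (Icc a b) x := by
  have hab : a ≤ b := hx.1.trans hx.2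
  have hh : ∀ n, Continuous fun y => f' n (projIcc a b hab y) := fun n =>
    (hc n).comp (continuous_subtype_val.comp continuous_projIcc)
  have key := hasDerivAt_tsum (y₀ := a) hu
    (g := fun n y => f n a + ∫ t in a..y, f' n (projIcc a b hab t))
    (g' := fun n y => f' n (projIcc a b hab y))
    (fun n y => ((hh n).integral_hasStrictDerivAt a y).hasDerivAt.const_add _)
    (fun n y => hb n _ (projIcc a b hab y).2) (by simpa using hs) x
  have hg : ∀ y ∈ Icc a b, ∀ n, f n a + ∫ t in a..y, f' n (projIcc a b hab t) = f n y := by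
    intro y hy n
    have h1 : ∫ t in a..y, f' n (projIcc a b hab t) = ∫ t in a..y, f' n t := by
      refine intervalIntegral.integral_congr fun t ht => ?_
      rw [uIcc_of_le hy.1] at ht
      simp only [projIcc_of_mem hab (⟨ht.1, ht.2.trans hy.2⟩ : t ∈ Icc a b)]
    rw [h1, intervalIntegral.integral_eq_sub_of_hasDerivAt (fun t _ => hf n t)
      ((hc n).intervalIntegrable _ _)]
    ring
  simp only [projIcc_of_mem hab hx] at key
  refine key.hasDerivWithinAt.congr (fun y hy => ?_) ?_
  · exact tsum_congr fun n => (hg y hy n).symm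
  · exact tsum_congr fun n => (hg x hx n).symm

theorem contDiffOn_tsum_Icc {f : ℕ → ℝ → ℝ} {u : ℕ → ℕ → ℝ} {a b : ℝ}
    (hu : ∀ m, Summable (u m)) (hf : ∀ n, ContDiff ℝ (⊤ : ℕ∞) (f n))
    (hb : ∀ m n, ∀ y ∈ Icc a b, |iteratedDeriv m (f n) y| ≤ u m n) :
    ContDiffOn ℝ (⊤ : ℕ∞) (fun y => ∑' n, f n y) (Icc a b) ∧
      ∀ m, ∀ y ∈ Icc a b,
        |iteratedDerivWithin m (fun y => ∑' n, f n y) (Icc a b) y| ≤ ∑' n, u m n := by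
  have hsum : ∀ m, ∀ y ∈ Icc a b, |∑' n, iteratedDeriv m (f n) y| ≤ ∑' n, u m n :=
    fun m y hy =>
    tsum_of_norm_bounded (f := fun n => iteratedDeriv m (f n) y) (hu m).hasSum
      fun n => hb m n y hy
  have hderiv : ∀ m, ∀ x ∈ Icc a b, HasDerivWithinAt (fun y => ∑' n, iteratedDeriv m (f n) y)
      (∑' n, iteratedDeriv (m + 1) (f n) x) (Icc a b) x := by
    intro m x hx
    refine hasDerivWithinAt_tsum_Icc (hu (m + 1)) (fun n y => ?_)
      (fun n => (hf n).continuous_iteratedDeriv (m + 1) (by exact_mod_cast le_top))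
      (hb (m + 1)) ?_ hx
    · rw [iteratedDeriv_succ]
      exact ((hf n).differentiable_iteratedDeriv m
        (by exact_mod_cast WithTop.coe_lt_top m)).differentiableAt.hasDerivAt
    · exact Summable.of_norm_bounded (hu m)
        fun n => hb m n a ⟨le_rfl, hx.1.trans hx.2⟩
  rcases lt_or_ge a b with hab | hab
  · have heq : ∀ m, ∀ x ∈ Icc a b, iteratedDerivWithin m (fun y => ∑' n, f n y) (Icc a b) x
        = ∑' n, iteratedDeriv m (f n) x := by
      intro m
      induction m with
      | zero => intro x _; simp
      | succ m ih =>
        intro x hx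
        rw [iteratedDerivWithin_succ, derivWithin_congr ih (ih x hx)]
        exact (hderiv m x hx).derivWithin (uniqueDiffOn_Icc hab x hx)
    refine ⟨contDiffOn_of_differentiableOn_deriv fun m _ x hx => ?_, fun m y hy => ?_⟩
    · exact (hderiv m x hx).differentiableWithinAt.congr (heq m) (heq m x hx)
    · rw [heq m y hy]
      exact hsum m y hy
  · have hss : (Icc a b).Subsingleton := subsingleton_Icc_of_ge hab
    refine ⟨contDiffOn_of_differentiableOn_deriv fun m _ => hss.differentiableOn, ?_⟩
    intro m y hy
    cases m with
    | zero => simpa using hsum 0 y hy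
    | succ m =>
      rw [iteratedDerivWithin_succ, derivWithin_zero_of_not_uniqueDiffWithinAt, abs_zero]
      · exact (abs_nonneg _).trans (hsum (m + 1) y hy)
      · intro h
        obtain ⟨z, hz, hzy⟩ := accPt_iff_nhds.1 (uniqueDiffWithinAt_iff_accPt.1 h) univ univ_mem
        exact hzy (hss hz.2 hy)

/-- Structure of the derivatives of the weighted composition `g' · (u ∘ g)`. -/
theorem exists_iteratedDeriv_deriv_mul_comp {g : ℝ → ℝ} (hg : ContDiff ℝ (⊤ : ℕ∞) g) (m : ℕ) :
    ∃ P : ℕ → ℝ → ℝ, (∀ j, ContDiff ℝ (⊤ : ℕ∞) (P j)) ∧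
      ∀ u : ℝ → ℝ, ContDiff ℝ (⊤ : ℕ∞) u → ∀ x,
        iteratedDeriv m (fun y => deriv g y * u (g y)) x =
          deriv g x ^ (m + 1) * iteratedDeriv m u (g x) +
            ∑ j ∈ Finset.range m, P j x * iteratedDeriv j u (g x) := by
  have hg' : ContDiff ℝ (⊤ : ℕ∞) (deriv g) := (contDiff_infty_iff_deriv.1 hg).2
  induction m with
  | zero => exact ⟨fun _ _ => 0, fun _ => contDiff_const, by simp⟩
  | succ m ih =>
    obtain ⟨P, hP, h⟩ := ih
    have hP' : ∀ j, ContDiff ℝ (⊤ : ℕ∞) (deriv (P j)) := fun j =>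
      (contDiff_infty_iff_deriv.1 (hP j)).2
    have hg'' : ContDiff ℝ (⊤ : ℕ∞) (deriv (deriv g)) := (contDiff_infty_iff_deriv.1 hg').2
    refine ⟨fun j y => (if j < m then deriv (P j) y else 0) +
      (if 0 < j then P (j - 1) y * deriv g y else 0) +
      (if j = m then ((m : ℝ) + 1) * deriv g y ^ m * deriv (deriv g) y else 0), fun j => ?_, ?_⟩
    · refine (ContDiff.add ?_ ?_).add ?_
      · split_ifs
        exacts [hP' j, contDiff_const]
      · split_ifs
        exacts [(hP _).mul hg', contDiff_const]
      · split_ifs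
        exacts [(contDiff_const.mul (hg'.pow m)).mul hg'', contDiff_const]
    · intro u hu x
      have hD : ∀ j, HasDerivAt (fun y => iteratedDeriv j u (g y))
          (iteratedDeriv (j + 1) u (g x) * deriv g x) x := by
        intro j
        rw [iteratedDeriv_succ]
        exact (hu.differentiable_iteratedDeriv j
          (by exact_mod_cast WithTop.coe_lt_top j)).differentiableAt.hasDerivAt.comp x
          ((contDiff_infty_iff_deriv.1 hg).1 x).hasDerivAt
      have hd : HasDerivAt (deriv g) (deriv (deriv g) x) x :=
        ((contDiff_infty_iff_deriv.1 hg').1 x).hasDerivAt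
      have hPd : ∀ j, HasDerivAt (P j) (deriv (P j) x) x := fun j =>
        ((contDiff_infty_iff_deriv.1 (hP j)).1 x).hasDerivAt
      have hsum := HasDerivAt.fun_sum (u := Finset.range m)
        (fun j _ => (hPd j).mul (hD j))
      rw [iteratedDeriv_succ, funext (h u hu)]
      refine (((hd.pow (m + 1)).mul (hD m)).add hsum).deriv.trans ?_
      rw [Finset.sum_add_distrib]
      simp only [add_mul _ _ (iteratedDeriv _ u (g x)), Finset.sum_add_distrib]
      have e1 : ∑ j ∈ Finset.range (m + 1), (if j < m then deriv (P j) x else 0) *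
          iteratedDeriv j u (g x) =
          ∑ j ∈ Finset.range m, deriv (P j) x * iteratedDeriv j u (g x) := by
        rw [Finset.sum_range_succ, if_neg (lt_irrefl m), zero_mul, add_zero]
        exact Finset.sum_congr rfl fun j hj => by rw [if_pos (Finset.mem_range.1 hj)]
      have e2 : ∑ j ∈ Finset.range (m + 1), (if 0 < j then P (j - 1) x * deriv g x else 0) *
          iteratedDeriv j u (g x) =
          ∑ j ∈ Finset.range m, P j x * (iteratedDeriv (j + 1) u (g x) * deriv g x) := by
        rw [Finset.sum_range_succ', if_neg (lt_irrefl 0), zero_mul, add_zero]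
        exact Finset.sum_congr rfl fun j _ => by
          rw [if_pos j.succ_pos, Nat.add_sub_cancel]; ring
      have e3 : ∑ j ∈ Finset.range (m + 1),
          (if j = m then ((m : ℝ) + 1) * deriv g x ^ m * deriv (deriv g) x else 0) *
          iteratedDeriv j u (g x) =
          ((m : ℝ) + 1) * deriv g x ^ m * deriv (deriv g) x *
            iteratedDeriv m u (g x) := by
        simp [ite_mul]
      rw [e1, e2, e3]
      simp only [Nat.cast_add, Nat.cast_one, Nat.add_sub_cancel, Pi.pow_apply]
      ring

theorem exists_uniform_bound_of_continuous {N : ℕ} {s : Fin N → Set ℝ}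
    (hs : ∀ i, IsCompact (s i)) {r : Fin N → Fin N → Prop} {F : Fin N → Fin N → ℝ → ℝ}
    (hF : ∀ i j, r i j → Continuous (F i j)) :
    ∃ K : ℝ, 0 ≤ K ∧ ∀ i j, r i j → ∀ x ∈ s i, F i j x ≤ K := by
  have h : ∀ i j, ∃ K : ℝ, 0 ≤ K ∧ (r i j → ∀ x ∈ s i, F i j x ≤ K) := by
    intro i j
    by_cases hr : r i j
    · obtain ⟨K, hK⟩ := (hs i).exists_bound_of_continuousOn (hF i j hr).continuousOn
      exact ⟨max K 0, le_max_right _ _, fun _ x hx =>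
        ((le_abs_self _).trans (hK x hx)).trans (le_max_left _ _)⟩
    · exact ⟨0, le_rfl, fun h => absurd h hr⟩
  choose K hK0 hK using h
  refine ⟨∑ i, ∑ j, K i j, Finset.sum_nonneg fun i _ => Finset.sum_nonneg fun j _ => hK0 i j,
    fun i j hr x hx => (hK i j hr x hx).trans ?_⟩
  exact (Finset.single_le_sum (f := fun j => K i j) (fun j _ => hK0 i j)
    (Finset.mem_univ j)).trans (Finset.single_le_sum (f := fun i => ∑ j, K i j)
      (fun i _ => Finset.sum_nonneg fun j _ => hK0 i j) (Finset.mem_univ i))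

theorem rightComp_succ_eq_comp_shift {N : ℕ} (φ : Fin N → Fin N → ℝ → ℝ) (w : ℕ → Fin N) (k : ℕ) :
    rightComp φ w (k + 1) = rightComp φ (fun l => w (l + 1)) k ∘ φ (w 0) (w 1) := by
  induction k with
  | zero => rfl
  | succ k ih => rw [rightComp, ih]; rfl

theorem contDiff_rightComp {N : ℕ} {φ : Fin N → Fin N → ℝ → ℝ} {w : ℕ → Fin N}
    (h : ∀ l, ContDiff ℝ (⊤ : ℕ∞) (φ (w l) (w (l + 1)))) (k : ℕ) :
    ContDiff ℝ (⊤ : ℕ∞) (rightComp φ w k) := by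
  induction k with
  | zero => exact contDiff_id
  | succ k ih => exact (h k).comp ih

/-- The `k`-th term `φ'_{w_{0,k}} · (τ' ∘ φ_{w_{0,k}})` of the series `-ζ_w`. -/
noncomputable def zetaTerm {N : ℕ} (φ : Fin N → Fin N → ℝ → ℝ) (τ : ℝ → ℝ)
    (w : ℕ → Fin N) (k : ℕ) (x : ℝ) : ℝ :=
  deriv (rightComp φ w k) x * deriv τ (rightComp φ w k x)

section zetaTerm

variable {N : ℕ} {φ : Fin N → Fin N → ℝ → ℝ} {τ : ℝ → ℝ} {w : ℕ → Fin N}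

theorem zetaTerm_zero : zetaTerm φ τ w 0 = deriv τ := by
  ext x
  simp [zetaTerm, rightComp]

theorem contDiff_zetaTerm (h : ∀ l, ContDiff ℝ (⊤ : ℕ∞) (φ (w l) (w (l + 1))))
    (hτ : ContDiff ℝ (⊤ : ℕ∞) τ) (k : ℕ) : ContDiff ℝ (⊤ : ℕ∞) (zetaTerm φ τ w k) :=
  (contDiff_infty_iff_deriv.1 (contDiff_rightComp h k)).2.mul
    ((contDiff_infty_iff_deriv.1 hτ).2.comp (contDiff_rightComp h k))

theorem zetaTerm_succ (h : ∀ l, ContDiff ℝ (⊤ : ℕ∞) (φ (w l) (w (l + 1)))) (k : ℕ) :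
    zetaTerm φ τ w (k + 1) = fun x =>
      deriv (φ (w 0) (w 1)) x * zetaTerm φ τ (fun l => w (l + 1)) k (φ (w 0) (w 1) x) := by
  ext x
  have h1 : DifferentiableAt ℝ (rightComp φ (fun l => w (l + 1)) k) (φ (w 0) (w 1) x) :=
    (contDiff_infty_iff_deriv.1 (contDiff_rightComp (fun l => h (l + 1)) k)).1 _
  have h2 : DifferentiableAt ℝ (φ (w 0) (w 1)) x := (contDiff_infty_iff_deriv.1 (h 0)).1 x
  rw [zetaTerm, rightComp_succ_eq_comp_shift, deriv_comp x h1 h2, Function.comp_apply, zetaTerm]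
  ring

end zetaTerm

/-- The term of index `k` is at most `θ ^ k * sup |τ'|`. -/
theorem abs_zetaTerm_le {N : ℕ} {s : Fin N → Set ℝ} {r : Fin N → Fin N → Prop}
    {φ : Fin N → Fin N → ℝ → ℝ} {τ : ℝ → ℝ} {θ M : ℝ}
    (hφ : ∀ i j, r i j → ContDiff ℝ (⊤ : ℕ∞) (φ i j))
    (hmaps : ∀ i j, r i j → MapsTo (φ i j) (s i) (s j)) (hθ : 0 ≤ θ)
    (hcontr : ∀ i j, r i j → ∀ x ∈ s i, |deriv (φ i j) x| ≤ θ)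
    (hM : ∀ i, ∀ x ∈ s i, |deriv τ x| ≤ M) (k : ℕ) {w : ℕ → Fin N}
    (hw : ∀ l, r (w l) (w (l + 1))) {x : ℝ} (hx : x ∈ s (w 0)) :
    |zetaTerm φ τ w k x| ≤ θ ^ k * M := by
  induction k generalizing w x with
  | zero => simpa [zetaTerm_zero] using hM _ x hx
  | succ k ih =>
    rw [zetaTerm_succ fun l => hφ _ _ (hw l), abs_mul, pow_succ', mul_assoc]
    exact mul_le_mul (hcontr _ _ (hw 0) x hx)
      (ih (fun l => hw (l + 1)) (hmaps _ _ (hw 0) hx)) (abs_nonneg _) hθ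

/-- All derivatives of the terms decay geometrically, uniformly in the word. -/
theorem exists_abs_iteratedDeriv_zetaTerm_le {N : ℕ} {s : Fin N → Set ℝ}
    (hs : ∀ i, IsCompact (s i)) {r : Fin N → Fin N → Prop}
    {φ : Fin N → Fin N → ℝ → ℝ} {τ : ℝ → ℝ} {θ ρ : ℝ}
    (hφ : ∀ i j, r i j → ContDiff ℝ (⊤ : ℕ∞) (φ i j)) (hτ : ContDiff ℝ (⊤ : ℕ∞) τ)
    (hmaps : ∀ i j, r i j → MapsTo (φ i j) (s i) (s j)) (hθ : 0 ≤ θ) (hθ1 : θ ≤ 1) (hρ : θ < ρ)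
    (hcontr : ∀ i j, r i j → ∀ x ∈ s i, |deriv (φ i j) x| ≤ θ) (m : ℕ) :
    ∃ C : ℝ, 0 ≤ C ∧ ∀ (k : ℕ) (w : ℕ → Fin N), (∀ l, r (w l) (w (l + 1))) → ∀ x ∈ s (w 0),
      |iteratedDeriv m (zetaTerm φ τ w k) x| ≤ C * ρ ^ k := by
  induction m using Nat.strong_induction_on with
  | _ m ih =>
  have ih' : ∀ j, ∃ C : ℝ, j < m → 0 ≤ C ∧ ∀ (k : ℕ) (w : ℕ → Fin N),
      (∀ l, r (w l) (w (l + 1))) → ∀ x ∈ s (w 0),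
      |iteratedDeriv j (zetaTerm φ τ w k) x| ≤ C * ρ ^ k := by
    intro j
    by_cases hj : j < m
    · exact (ih j hj).imp fun C hC _ => hC
    · exact ⟨0, fun h => absurd h hj⟩
  choose C hC using ih'
  have hP : ∀ i j, ∃ P : ℕ → ℝ → ℝ, r i j → (∀ n, ContDiff ℝ (⊤ : ℕ∞) (P n)) ∧
      ∀ u : ℝ → ℝ, ContDiff ℝ (⊤ : ℕ∞) u → ∀ x,
        iteratedDeriv m (fun y => deriv (φ i j) y * u (φ i j y)) x =
          deriv (φ i j) x ^ (m + 1) * iteratedDeriv m u (φ i j x) +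
            ∑ n ∈ Finset.range m, P n x * iteratedDeriv n u (φ i j x) := by
    intro i j
    by_cases hr : r i j
    · exact (exists_iteratedDeriv_deriv_mul_comp (hφ i j hr) m).imp fun P hP _ => hP
    · exact ⟨fun _ _ => 0, fun h => absurd h hr⟩
  choose P hP using hP
  obtain ⟨K, hK0, hK⟩ := exists_uniform_bound_of_continuous hs (r := r)
    (F := fun i j x => ∑ n ∈ Finset.range m, |P i j n x| * C n)
    (fun i j hr => continuous_finsetSum _ fun n _ =>
      (((hP i j hr).1 n).continuous.abs).mul continuous_const)
  obtain ⟨A, hA0, hA⟩ := exists_uniform_bound_of_continuous hs (r := r)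
    (F := fun _ _ x => |iteratedDeriv m (deriv τ) x|)
    (fun _ _ _ => ((contDiff_infty_iff_deriv.1 hτ).2.continuous_iteratedDeriv m
      (by exact_mod_cast le_top)).abs)
  have hρ0 : 0 < ρ := hθ.trans_lt hρ
  have hB : K ≤ (ρ - θ) * max A (K / (ρ - θ)) := by
    rw [← div_le_iff₀' (sub_pos.2 hρ)]
    exact le_max_right _ _
  refine ⟨max A (K / (ρ - θ)), hA0.trans (le_max_left _ _), fun k => ?_⟩
  generalize hBdef : max A (K / (ρ - θ)) = B at hB
  have hAB : A ≤ B := hBdef ▸ le_max_left _ _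
  induction k with
  | zero =>
    intro w hw x hx
    rw [zetaTerm_zero, pow_zero, mul_one]
    exact (hA _ _ (hw 0) x hx).trans hAB
  | succ k ihk =>
    intro w hw x hx
    have hw' : ∀ l, r (w (l + 1)) (w (l + 1 + 1)) := fun l => hw (l + 1)
    have hy : φ (w 0) (w 1) x ∈ s (w 1) := hmaps _ _ (hw 0) hx
    have hk0 : 0 ≤ ρ ^ k := pow_nonneg hρ0.le k
    rw [zetaTerm_succ fun l => hφ _ _ (hw l), (hP _ _ (hw 0)).2 _
      (contDiff_zetaTerm (fun l => hφ _ _ (hw' l)) hτ k)]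
    have hpow : |deriv (φ (w 0) (w 1)) x ^ (m + 1)| ≤ θ := by
      rw [abs_pow]
      exact (pow_le_pow_left₀ (abs_nonneg _) (hcontr _ _ (hw 0) x hx) _).trans
        (pow_le_of_le_one hθ hθ1 m.succ_ne_zero)
    have hmain : |deriv (φ (w 0) (w 1)) x ^ (m + 1) *
        iteratedDeriv m (zetaTerm φ τ (fun l => w (l + 1)) k) (φ (w 0) (w 1) x)| ≤
        θ * (B * ρ ^ k) := by
      rw [abs_mul]
      exact mul_le_mul hpow (ihk _ hw' _ hy) (abs_nonneg _) hθ
    have hlow : |∑ n ∈ Finset.range m, P (w 0) (w 1) n x *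
        iteratedDeriv n (zetaTerm φ τ (fun l => w (l + 1)) k) (φ (w 0) (w 1) x)| ≤ K * ρ ^ k := by
      refine (Finset.abs_sum_le_sum_abs _ _).trans ?_
      refine le_trans ?_ (mul_le_mul_of_nonneg_right (hK _ _ (hw 0) x hx) hk0)
      rw [Finset.sum_mul]
      refine Finset.sum_le_sum fun n hn => ?_
      rw [abs_mul, mul_assoc]
      exact mul_le_mul_of_nonneg_left
        ((hC n (Finset.mem_range.1 hn)).2 k _ hw' _ hy) (abs_nonneg _)
    calc _ ≤ θ * (B * ρ ^ k) + K * ρ ^ k := (abs_add_le _ _).trans (add_le_add hmain hlow)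
      _ ≤ θ * (B * ρ ^ k) + (ρ - θ) * B * ρ ^ k := by gcongr
      _ = B * ρ ^ (k + 1) := by ring

/-- for every admissible right-infinite word, the series defining `ζ_w`
converges uniformly on `I_{w₀}`, `ζ_w` is smooth on `I_{w₀}`,
`|ζ_w| ≤ (θ/(1−θ))·max_I|τ'|`, and all its derivatives are bounded uniformly in `w`. -/
theorem zeta_series_properties
    (N : ℕ) (hN : 1 ≤ N)
    (Iv : Fin N → Set ℝ) (aa bb : Fin N → ℝ)
    (hIcc : ∀ i, Iv i = Set.Icc (aa i) (bb i)) (hab : ∀ i, aa i ≤ bb i)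
    (hdisj : ∀ i j, i ≠ j → Disjoint (Iv i) (Iv j))
    (Adj : Fin N → Fin N → Prop)
    (φ : Fin N → Fin N → ℝ → ℝ)
    (hφsm : ∀ i j, Adj i j → ContDiff ℝ (⊤ : ℕ∞) (φ i j))
    (hφinj : ∀ i j, Adj i j → Set.InjOn (φ i j) (Iv i))
    (hφd0 : ∀ i j, Adj i j → ∀ x ∈ Iv i, deriv (φ i j) x ≠ 0)
    (hmaps : ∀ i j, Adj i j → φ i j '' Iv i ⊆ interior (Iv j))
    (θ : ℝ) (hθ0 : 0 < θ) (hθ1 : θ < 1)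
    (hcontr : ∀ i j, Adj i j → ∀ x ∈ Iv i, |deriv (φ i j) x| ≤ θ)
    (hsep : ∀ i j k l, Adj i j → Adj k l →
      (φ i j '' Iv i ∩ φ k l '' Iv k).Nonempty → i = k ∧ j = l)
    (τ : ℝ → ℝ) (hτ : ContDiff ℝ (⊤ : ℕ∞) τ)
    (M : ℝ) (hM : IsGreatest ((fun x => |deriv τ x|) '' ⋃ i, Iv i) M) :
    (∀ w : ℕ → Fin N, (∀ l, Adj (w l) (w (l + 1))) →
      TendstoUniformlyOn
        (fun n x => -(∑ k ∈ Finset.range n,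
          deriv (rightComp φ w (k + 1)) x * deriv τ (rightComp φ w (k + 1) x)))
        (zetaFn φ τ w) Filter.atTop (Iv (w 0)) ∧
      ContDiffOn ℝ (⊤ : ℕ∞) (zetaFn φ τ w) (Iv (w 0)) ∧
      ∀ x ∈ Iv (w 0), |zetaFn φ τ w x| ≤ θ / (1 - θ) * M) ∧
    (∀ α : ℕ, ∃ C : ℝ, 0 < C ∧ ∀ w : ℕ → Fin N, (∀ l, Adj (w l) (w (l + 1))) →
      ∀ x ∈ Iv (w 0),
        |iteratedDerivWithin α (zetaFn φ τ w) (Iv (w 0)) x| ≤ C) := by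
  have hs : ∀ i, IsCompact (Iv i) := fun i => hIcc i ▸ isCompact_Icc
  have hmaps' : ∀ i j, Adj i j → MapsTo (φ i j) (Iv i) (Iv j) := fun i j h x hx =>
    interior_subset (hmaps i j h (mem_image_of_mem _ hx))
  have hM' : ∀ i, ∀ x ∈ Iv i, |deriv τ x| ≤ M := fun i x hx =>
    hM.2 (mem_image_of_mem _ (mem_iUnion_of_mem i hx))
  obtain ⟨ρ, hρ, hρ1⟩ := exists_between hθ1
  have hρ0 : 0 < ρ := hθ0.trans hρ
  choose C hC0 hC using exists_abs_iteratedDeriv_zetaTerm_le hs hφsm hτ hmaps' hθ0.le hθ1.le hρ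
    hcontr
  have hgeom : ∀ {t : ℝ}, 0 ≤ t → t < 1 → ∀ c : ℝ,
      HasSum (fun k : ℕ => c * t ^ (k + 1)) (c * (t / (1 - t))) := fun {t} h0 h1 c => by
    simpa [pow_succ', div_eq_mul_inv] using
      ((hasSum_geometric_of_lt_one h0 h1).mul_left t).mul_left c
  have hbound : ∀ w : ℕ → Fin N, (∀ l, Adj (w l) (w (l + 1))) → ∀ k, ∀ x ∈ Iv (w 0),
      ‖zetaTerm φ τ w (k + 1) x‖ ≤ M * θ ^ (k + 1) := fun w hw k x hx =>
    (abs_zetaTerm_le hφsm hmaps' hθ0.le hcontr hM' (k + 1) hw hx).trans_eq (mul_comm _ _)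
  have hsmooth := fun (w : ℕ → Fin N) (hw : ∀ l, Adj (w l) (w (l + 1))) =>
    contDiffOn_tsum_Icc (f := fun k => zetaTerm φ τ w (k + 1))
      (u := fun m k => C m * ρ ^ (k + 1)) (a := aa (w 0)) (b := bb (w 0))
      (fun m => (hgeom hρ0.le hρ1 (C m)).summable)
      (fun k => contDiff_zetaTerm (fun l => hφsm _ _ (hw l)) hτ (k + 1))
      (fun m k y hy => hC m (k + 1) w hw y (hIcc (w 0) ▸ hy))
  have hzeta : ∀ w, zetaFn φ τ w = -fun x => ∑' k, zetaTerm φ τ w (k + 1) x := fun _ => rfl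
  refine ⟨fun w hw => ⟨?_, ?_, fun x hx => ?_⟩, fun m => ?_⟩
  · exact (tendstoUniformlyOn_tsum_nat (hgeom hθ0.le hθ1 M).summable (hbound w hw)).neg
  · rw [hzeta, hIcc]
    exact (hsmooth w hw).1.neg
  · rw [hzeta, Pi.neg_apply, abs_neg, mul_comm]
    exact tsum_of_norm_bounded (hgeom hθ0.le hθ1 M) fun k => hbound w hw k x hx
  · refine ⟨C m * (ρ / (1 - ρ)) + 1, add_pos_of_nonneg_of_pos
      (mul_nonneg (hC0 m) (div_nonneg hρ0.le (sub_pos.2 hρ1).le)) one_pos, fun w hw x hx => ?_⟩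
    rw [hIcc] at hx
    rw [hzeta, hIcc, iteratedDerivWithin_neg, abs_neg]
    refine ((hsmooth w hw).2 m x hx).trans ?_
    rw [(hgeom hρ0.le hρ1 (C m)).tsum_eq]
    exact (lt_add_one _).le
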